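/- The language {aⁿbⁿcⁿ : n ≥ 1} is the Szilard language of some labeled flat splicing system of type (4, 1) whose initial set is a regular language; that is, {aⁿbⁿcⁿ : n ≥ 1} ∈ SZLS^4_{1,REG}. -/

import Mathlib

/-- A flat splicing rule `⟨α | γ−δ | β⟩`. -/
structure FlatRule (A : Type) where
  /-- left handle α -/
  lf : List A
  /-- right handle β -/
  rt : List A
  /-- first letter γ of the inserted word (a word of length ≤ 1) -/
  ins1 : List A
  /-- last letter δ of the inserted word (a word of length ≤ 1) -/
  ins2 : List A

/-- Application of a flat splicing rule: from `u = x·α·β·y` and `v = γ·z·δ` (with `|v| ≥ 1`)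
produce `w = x·α·v·β·y`. -/
def FlatRule.Splice {A : Type} (r : FlatRule A) (u v w : List A) : Prop :=
  ∃ x y z : List A,
    u = x ++ r.lf ++ r.rt ++ y ∧
    v = r.ins1 ++ z ++ r.ins2 ∧ 1 ≤ v.length ∧
    w = x ++ r.lf ++ v ++ r.rt ++ y

/-- A labeled flat splicing system `(A, I, R, Lab)`; every rule carries a label word over `Λ`
(a single letter for Szilard/control labelings, possibly the empty word for λ-labelings). -/
structure LabeledFSS (A Λ : Type) where
  I : Set (List A)
  R : Set (FlatRule A)
  lab : FlatRule A → List Λ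
  finR : R.Finite
  insBound : ∀ r ∈ R, r.ins1.length ≤ 1 ∧ r.ins2.length ≤ 1

namespace LabeledFSS

variable {A Λ : Type} (S : LabeledFSS A Λ)

/-- Some rule of the system is applicable to the word `u` (together with some initial word). -/
def Applicable (u : List A) : Prop :=
  ∃ r ∈ S.R, ∃ v ∈ S.I, ∃ w, r.Splice u v w

/-- `S.Deriv x ls` : starting from initial words, the word `x` is derivable with label word `ls`. -/
inductive Deriv : List A → List Λ → Prop
  | start {x₀ y₀ x₁ : List A} {r : FlatRule A} :
      x₀ ∈ S.I → y₀ ∈ S.I → r ∈ S.R → r.Splice x₀ y₀ x₁ → Deriv x₁ (S.lab r)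
  | step {x y w : List A} {ls : List Λ} {r : FlatRule A} :
      Deriv x ls → y ∈ S.I → r ∈ S.R → r.Splice x y w → Deriv w (ls ++ S.lab r)

/-- The derivation language (Szilard language resp. control language) of the system:
label words of terminal derivations. -/
def derLang : Language Λ :=
  { ls | ∃ x : List A, S.Deriv x ls ∧ ¬ S.Applicable x }

/-- The system has type `(m, n)`: `m` is the maximum length of the handles `α, β`
and `n` is the maximum length of `γδ` over all rules. -/
def HasType (m n : ℕ) : Prop :=
  (∀ r ∈ S.R, r.lf.length ≤ m ∧ r.rt.length ≤ m) ∧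
  (∃ r ∈ S.R, r.lf.length = m ∨ r.rt.length = m) ∧
  (∀ r ∈ S.R, r.ins1.length + r.ins2.length ≤ n) ∧
  (∃ r ∈ S.R, r.ins1.length + r.ins2.length = n)

/-- Szilard labeling: each rule is labeled by a single letter, in a one-to-one manner. -/
def SzilardLabeled : Prop :=
  (∀ r ∈ S.R, (S.lab r).length = 1) ∧ Set.InjOn S.lab S.R

/-- Control labeling: each rule is labeled by a single letter
(distinct rules may share a label). -/
def ControlLabeled : Prop :=
  ∀ r ∈ S.R, (S.lab r).length = 1

/-- λ-control labeling: each rule is labeled by a single letter or by the empty word. -/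
def LambdaControlLabeled : Prop :=
  ∀ r ∈ S.R, (S.lab r).length ≤ 1

end LabeledFSS

/-- A three-letter alphabet `{a, b, c}`. -/
inductive ABC : Type
  | a
  | b
  | c
deriving DecidableEq

namespace TripleCount

/-- The working alphabet: the inserted letters `A`, `B`, `C` and the site letter `X`. -/
inductive Letter : Type
  | A
  | B
  | C
  | X
deriving DecidableEq

instance : Fintype Letter := ⟨{.A, .B, .C, .X}, by rintro ⟨⟩ <;> simp⟩

open Letter

/-- `w ^ n` followed by `t`. -/
def rep (w : List Letter) : ℕ → List Letter → List Letter
  | 0, t => t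
  | n + 1, t => w ++ rep w n t

lemma rep_zero (w t : List Letter) : rep w 0 t = t := rfl

lemma rep_succ (w : List Letter) (n : ℕ) (t : List Letter) :
    rep w (n + 1) t = w ++ rep w n t := rfl

lemma rep_append (w : List Letter) (n : ℕ) (t : List Letter) :
    rep w n (w ++ t) = rep w (n + 1) t := by
  induction n with
  | zero => rfl
  | succ n ih => rw [rep_succ, ih, ← rep_succ]

/-- The word `w` arises from `u` by inserting `v` between the handles `l` and `r`. -/
def Ins (l r v u w : List Letter) : Prop :=
  ∃ x y, u = x ++ l ++ r ++ y ∧ w = x ++ l ++ v ++ r ++ y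

lemma ins_nil (a : Letter) (l r v w : List Letter) : Ins (a :: l) r v [] w ↔ False := by
  simp [Ins]

lemma ins_cons (l r v u w : List Letter) (a : Letter) :
    Ins l r v (a :: u) w ↔
      (∃ y, a :: u = l ++ r ++ y ∧ w = l ++ v ++ r ++ y) ∨
        ∃ w', w = a :: w' ∧ Ins l r v u w' := by
  constructor
  · rintro ⟨x, y, hu, hw⟩
    cases x with
    | nil => exact Or.inl ⟨y, by simpa using hu, by simpa using hw⟩
    | cons d x =>
      simp only [List.cons_append, List.cons.injEq] at hu
      obtain ⟨rfl, hu⟩ := hu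
      exact Or.inr ⟨x ++ l ++ v ++ r ++ y, by simpa using hw, x, y, hu, rfl⟩
  · rintro (⟨y, hu, hw⟩ | ⟨w', rfl, x, y, rfl, rfl⟩)
    · exact ⟨[], y, by simpa using hu, by simpa using hw⟩
    · exact ⟨a :: x, y, by simp, by simp⟩

/-- Insertion of `A` by the rule labeled `a`. -/
abbrev InsA : List Letter → List Letter → Prop := Ins [A, X] [X] [A]

/-- Insertion of `B` by the rule labeled `b`. -/
abbrev InsB : List Letter → List Letter → Prop := Ins [X] [A, X, B] [B]

/-- Insertion of `C` by the rule labeled `c`. -/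
abbrev InsC : List Letter → List Letter → Prop := Ins [C, A, X, B] [A] [C]

/-- The word reached after `i` insertions of `A`, with `m` insertions of `A` still to come. -/
def wordA (i m : ℕ) : List Letter := C :: rep [A, X] (i + 1) (rep [X] m [B])

/-- The word reached after `q` insertions of `B`, with `p` insertions of `B` still to come. -/
def wordB (p q : ℕ) : List Letter := C :: rep [A, X] p (rep [A, X, B] (q + 1) [])

/-- The word reached after `s` insertions of `C`, with `t` insertions of `C` still to come. -/
def wordC (s t : ℕ) : List Letter := rep [C, A, X, B] (s + 1) (rep [A, X, B] t [])

lemma wordA_zero (i : ℕ) : wordA i 0 = wordB i 0 := by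
  simp only [wordA, wordB, ← rep_append]
  rfl

lemma wordB_zero (q : ℕ) : wordB 0 q = wordC 0 q := rfl

lemma not_insA_X (m : ℕ) (w : List Letter) : ¬ InsA (rep [X] m [B]) w := by
  induction m generalizing w with
  | zero => simp [rep_zero, ins_cons, ins_nil]
  | succ m ih => simp [rep_succ, ins_cons, ih]

lemma insA_wordA (i m : ℕ) (w : List Letter) :
    InsA (wordA i m) w ↔ ∃ m', m = m' + 1 ∧ w = wordA (i + 1) m' := by
  have key : ∀ w, InsA (rep [A, X] (i + 1) (rep [X] m [B])) w ↔
      ∃ m', m = m' + 1 ∧ w = rep [A, X] (i + 2) (rep [X] m' [B]) := by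
    intro w
    induction i generalizing w with
    | zero => cases m <;> simp [rep_succ, rep_zero, ins_cons, not_insA_X, ins_nil]
    | succ i ih =>
      rw [rep_succ]
      simp only [List.cons_append, List.nil_append, ins_cons, ih]
      simp [rep_succ]
      grind
  simp only [wordA, ins_cons, key]
  simp
  grind

lemma not_insA_AXB (q : ℕ) (w : List Letter) : ¬ InsA (rep [A, X, B] q []) w := by
  induction q generalizing w with
  | zero => simp [rep_zero, ins_nil]
  | succ q ih => simp [rep_succ, ins_cons, ih]

lemma not_insA_wordB (p q : ℕ) (w : List Letter) : ¬ InsA (wordB p q) w := by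
  have key : ∀ w, ¬ InsA (rep [A, X] p (rep [A, X, B] (q + 1) [])) w := by
    induction p with
    | zero => exact not_insA_AXB _
    | succ p ih =>
      intro w
      cases p with
      | zero => simp [rep_succ, rep_zero, ins_cons, not_insA_AXB]
      | succ p =>
        simp only [rep_succ] at ih ⊢
        simp only [List.cons_append, List.nil_append, ins_cons] at ih ⊢
        simp at ih ⊢
        grind
  simp [wordB, ins_cons, key]

lemma not_insA_wordC (s t : ℕ) (w : List Letter) : ¬ InsA (wordC s t) w := by
  unfold wordC
  generalize s + 1 = s
  induction s generalizing w with
  | zero => exact not_insA_AXB _ _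
  | succ s ih => simp [rep_succ, ins_cons, ih]

lemma rep_X_ne (m : ℕ) (y : List Letter) : rep [X] m [B] ≠ A :: y := by
  cases m <;> simp [rep_succ, rep_zero]

lemma not_insB_X (m : ℕ) (w : List Letter) : ¬ InsB (rep [X] m [B]) w := by
  induction m generalizing w with
  | zero => simp [rep_zero, ins_cons, ins_nil]
  | succ m ih => simp [rep_succ, ins_cons, ih, rep_X_ne]

lemma not_insB_wordA (i m : ℕ) (w : List Letter) : ¬ InsB (wordA i (m + 1)) w := by
  have key : ∀ w, ¬ InsB (rep [A, X] (i + 1) (rep [X] (m + 1) [B])) w := by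
    induction i with
    | zero => simp [rep_succ, rep_zero, ins_cons, not_insB_X, rep_X_ne]
    | succ i ih =>
      intro w
      rw [rep_succ]
      simp only [List.cons_append, List.nil_append, ins_cons, ih]
      cases i <;> simp [rep_succ, rep_zero]
  simp [wordA, ins_cons, key]

lemma not_insB_AXB (q : ℕ) (w : List Letter) : ¬ InsB (rep [A, X, B] q []) w := by
  induction q generalizing w with
  | zero => simp [rep_zero, ins_nil]
  | succ q ih => simp [rep_succ, ins_cons, ih]

lemma insB_wordB (p q : ℕ) (w : List Letter) :
    InsB (wordB p q) w ↔ ∃ p', p = p' + 1 ∧ w = wordB p' (q + 1) := by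
  have key : ∀ w, InsB (rep [A, X] p (rep [A, X, B] (q + 1) [])) w ↔
      ∃ p', p = p' + 1 ∧ w = rep [A, X] p' (rep [A, X, B] (q + 2) []) := by
    induction p with
    | zero => simp [rep_zero, not_insB_AXB]
    | succ p ih =>
      intro w
      rw [rep_succ]
      simp only [List.cons_append, List.nil_append, ins_cons, ih]
      cases p with
      | zero => simp [rep_succ, rep_zero]
      | succ p => cases p <;> simp [rep_succ, rep_zero]
  simp only [wordB, ins_cons, key]
  simp
  grind

lemma not_insB_wordC (s t : ℕ) (w : List Letter) : ¬ InsB (wordC s t) w := by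
  unfold wordC
  generalize s + 1 = s
  induction s generalizing w with
  | zero => exact not_insB_AXB _ _
  | succ s ih => simp [rep_succ, ins_cons, ih]

lemma not_insC_of_not_mem {u : List Letter} (h : C ∉ u) (w : List Letter) : ¬ InsC u w := by
  rintro ⟨x, y, rfl, -⟩
  simp at h

lemma not_mem_rep {a : Letter} {u t : List Letter} (hu : a ∉ u) (ht : a ∉ t) (n : ℕ) :
    a ∉ rep u n t := by
  induction n with
  | zero => exact ht
  | succ n ih => simp [rep_succ, hu, ih]

lemma not_insC_wordA (i m : ℕ) (w : List Letter) : ¬ InsC (wordA i (m + 1)) w := by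
  have h (w) := not_insC_of_not_mem (u := rep [A, X] (i + 1) (rep [X] (m + 1) [B]))
    (not_mem_rep (by simp) (not_mem_rep (by simp) (by simp) _) _) w
  simp only [wordA, ins_cons, h]
  cases i <;> simp [rep_succ, rep_zero]

lemma not_insC_wordB (p q : ℕ) (w : List Letter) : ¬ InsC (wordB (p + 1) q) w := by
  have h (w) := not_insC_of_not_mem (u := rep [A, X] (p + 1) (rep [A, X, B] (q + 1) []))
    (not_mem_rep (by simp) (not_mem_rep (by simp) (by simp) _) _) w
  simp only [wordB, ins_cons, h]
  cases p <;> simp [rep_succ, rep_zero]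

lemma insC_wordC (s t : ℕ) (w : List Letter) :
    InsC (wordC s t) w ↔ ∃ t', t = t' + 1 ∧ w = wordC (s + 1) t' := by
  have h (t w) := not_insC_of_not_mem (u := rep [A, X, B] t [])
    (not_mem_rep (by simp) (by simp) _) w
  unfold wordC
  induction s generalizing w with
  | zero =>
    simp only [rep_succ, rep_zero, List.cons_append, List.nil_append, ins_cons, h]
    cases t <;> simp [rep_succ, rep_zero]
  | succ s ih =>
    rw [rep_succ]
    simp only [List.cons_append, List.nil_append, ins_cons, ih]
    simp [rep_succ]
    grind


/-- The initial words. -/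
def initial : Set (List Letter) :=
  {v | v = [A] ∨ v = [B] ∨ v = [C] ∨ ∃ k, v = wordA 0 k}

/-- An automaton for the initial words; state `5` is the sink. -/
def initialDFA : DFA Letter (Fin 6) where
  step
    | 0, A => 1
    | 0, B => 1
    | 0, C => 2
    | 2, A => 3
    | 3, X => 4
    | 4, X => 4
    | 4, B => 1
    | _, _ => 5
  start := 0
  accept := {1, 2}

lemma evalFrom_sink (v : List Letter) : initialDFA.evalFrom 5 v = 5 := by
  induction v with
  | nil => rfl
  | cons d v ih => cases d <;> exact ih

lemma evalFrom_one_mem (v : List Letter) :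
    initialDFA.evalFrom 1 v ∈ initialDFA.accept ↔ v = [] := by
  cases v with
  | nil => simp [initialDFA]
  | cons d v =>
    have : initialDFA.evalFrom 1 (d :: v) = 5 := by cases d <;> exact evalFrom_sink v
    rw [this]
    simp [initialDFA]

lemma evalFrom_four_mem (v : List Letter) :
    initialDFA.evalFrom 4 v ∈ initialDFA.accept ↔ ∃ k, v = rep [X] k [B] := by
  have sink : ¬ (5 : Fin 6) ∈ initialDFA.accept := by simp [initialDFA]
  induction v with
  | nil =>
    have hk (k) : [] ≠ rep [X] k [B] := by cases k <;> simp [rep_succ, rep_zero]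
    simp [initialDFA, hk]
  | cons d v ih =>
    cases d with
    | A =>
      have hk (k) : A :: v ≠ rep [X] k [B] := (rep_X_ne k v).symm
      simp only [hk, exists_false, iff_false]
      exact (evalFrom_sink v).symm ▸ sink
    | B =>
      refine (evalFrom_one_mem v).trans ⟨fun h => ⟨0, by simp [h, rep_zero]⟩, ?_⟩
      rintro ⟨k, hk⟩
      cases k <;> simp_all [rep_succ, rep_zero]
    | C =>
      have hk (k) : C :: v ≠ rep [X] k [B] := by cases k <;> simp [rep_succ, rep_zero]
      simp only [hk, exists_false, iff_false]
      exact (evalFrom_sink v).symm ▸ sink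
    | X =>
      refine ih.trans ⟨fun ⟨k, hk⟩ => ⟨k + 1, by simp [hk, rep_succ]⟩, ?_⟩
      rintro ⟨k, hk⟩
      cases k with
      | zero => simp [rep_zero] at hk
      | succ k => exact ⟨k, by simpa [rep_succ] using hk⟩

lemma isRegular_initial : Language.IsRegular (initial : Language Letter) := by
  refine ⟨Fin 6, inferInstance, initialDFA, Set.ext fun v => ?_⟩
  have sink : ¬ (5 : Fin 6) ∈ initialDFA.accept := by simp [initialDFA]
  have bad : ∀ v', initialDFA.evalFrom 5 v' ∉ initialDFA.accept :=
    fun v' => (evalFrom_sink v').symm ▸ sink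
  change initialDFA.evalFrom 0 v ∈ initialDFA.accept ↔
    v = [A] ∨ v = [B] ∨ v = [C] ∨ ∃ k, v = C :: A :: X :: rep [X] k [B]
  rcases v with _ | ⟨_ | _ | _ | _, v⟩
  · simp [initialDFA]
  · exact (evalFrom_one_mem v).trans (by simp)
  · exact (evalFrom_one_mem v).trans (by simp)
  · change initialDFA.evalFrom 2 v ∈ initialDFA.accept ↔ _
    rcases v with _ | ⟨_ | _ | _ | _, v⟩
    · simp [initialDFA]
    · change initialDFA.evalFrom 3 v ∈ initialDFA.accept ↔ _
      rcases v with _ | ⟨_ | _ | _ | _, v⟩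
      · simp [initialDFA]
      · exact iff_of_false (bad v) (by simp)
      · exact iff_of_false (bad v) (by simp)
      · exact iff_of_false (bad v) (by simp)
      · exact (evalFrom_four_mem v).trans (by simp)
    · exact iff_of_false (bad v) (by simp)
    · exact iff_of_false (bad v) (by simp)
    · exact iff_of_false (bad v) (by simp)
  · exact iff_of_false (bad v) (by simp)

/-- The rule labeled `a`. -/
def ruleA : FlatRule Letter := ⟨[A, X], [X], [A], []⟩

/-- The rule labeled `b`. -/
def ruleB : FlatRule Letter := ⟨[X], [A, X, B], [B], []⟩

/-- The rule labeled `c`. -/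
def ruleC : FlatRule Letter := ⟨[C, A, X, B], [A], [], [C]⟩

/-- A labeled flat splicing system whose Szilard language is `{aⁿbⁿcⁿ : n ≥ 1}`. -/
def system : LabeledFSS Letter ABC where
  I := initial
  R := {ruleA, ruleB, ruleC}
  lab r := match r.lf.length with
    | 2 => [ABC.a]
    | 1 => [ABC.b]
    | _ => [ABC.c]
  finR := Set.toFinite _
  insBound := by simp [ruleA, ruleB, ruleC]

lemma splice_iff_ins {r : FlatRule Letter} {l : Letter}
    (hl : [l] ∈ initial)
    (h : ∀ v ∈ initial, (∃ z, v = r.ins1 ++ z ++ r.ins2) ↔ v = [l]) (u w : List Letter) :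
    (∃ v ∈ initial, r.Splice u v w) ↔ Ins r.lf r.rt [l] u w := by
  constructor
  · rintro ⟨v, hv, x, y, z, hu, hz, -, hw⟩
    obtain rfl := (h v hv).1 ⟨z, hz⟩
    exact ⟨x, y, hu, hw⟩
  · rintro ⟨x, y, hu, hw⟩
    obtain ⟨z, hz⟩ := (h _ hl).2 rfl
    exact ⟨[l], hl, x, y, z, hu, hz, by simp, hw⟩

lemma spliceA_iff (u w : List Letter) :
    (∃ v ∈ initial, ruleA.Splice u v w) ↔ InsA u w := by
  refine splice_iff_ins (by simp [initial]) ?_ u w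
  rintro _ (rfl | rfl | rfl | ⟨k, rfl⟩) <;> simp [ruleA, wordA]

lemma spliceB_iff (u w : List Letter) :
    (∃ v ∈ initial, ruleB.Splice u v w) ↔ InsB u w := by
  refine splice_iff_ins (by simp [initial]) ?_ u w
  rintro _ (rfl | rfl | rfl | ⟨k, rfl⟩) <;> simp [ruleB, wordA]

lemma getLast?_rep_X (k : ℕ) : (rep [X] k [B]).getLast? = some B := by
  induction k with
  | zero => rfl
  | succ k ih => simp [rep_succ, List.getLast?_cons, ih]

lemma spliceC_iff (u w : List Letter) :
    (∃ v ∈ initial, ruleC.Splice u v w) ↔ InsC u w := by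
  refine splice_iff_ins (by simp [initial]) ?_ u w
  rintro _ (rfl | rfl | rfl | ⟨k, rfl⟩)
  · simp [ruleC, List.singleton_eq_append_iff]
  · simp [ruleC, List.singleton_eq_append_iff]
  · simp [ruleC]
  · refine iff_of_false ?_ (by simp [wordA, rep_succ])
    rintro ⟨z, hz⟩
    have := congrArg List.getLast? hz
    simp [ruleC, wordA, rep_succ, rep_zero, List.getLast?_cons, getLast?_rep_X] at this

lemma applicable_iff (u : List Letter) :
    system.Applicable u ↔ ∃ w, InsA u w ∨ InsB u w ∨ InsC u w := by
  simp only [← spliceA_iff, ← spliceB_iff, ← spliceC_iff]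
  simp only [LabeledFSS.Applicable, system, Set.mem_insert_iff, Set.mem_singleton_iff]
  grind

/-- The word `x` is initial or derivable, with label word `ls`. -/
def Reach (x : List Letter) (ls : List ABC) : Prop :=
  x ∈ initial ∧ ls = [] ∨ system.Deriv x ls

lemma Reach.deriv {x w : List Letter} {ls : List ABC} {r : FlatRule Letter} (h : Reach x ls)
    (hr : r ∈ system.R) (hs : ∃ v ∈ initial, r.Splice x v w) :
    system.Deriv w (ls ++ system.lab r) := by
  obtain ⟨v, hv, hs⟩ := hs
  rcases h with ⟨hx, rfl⟩ | h
  · exact .start hx hv hr hs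
  · exact .step h hv hr hs

open List in
/-- The pairs of a word and a label word met along derivations. -/
inductive Config : List Letter → List ABC → Prop
  | phaseA (i m : ℕ) : Config (wordA i (m + 1)) (replicate i .a)
  | phaseB (p q : ℕ) :
      Config (wordB (p + 1) q) (replicate (p + 1 + q) .a ++ replicate q .b)
  | phaseC (s t : ℕ) :
      Config (wordC s t) (replicate (s + t) .a ++ replicate (s + t) .b ++ replicate s .c)

lemma Config.step {x w : List Letter} {ls : List ABC} {r : FlatRule Letter} (h : Config x ls)
    (hr : r ∈ system.R) (hs : ∃ v ∈ initial, r.Splice x v w) :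
    Config w (ls ++ system.lab r) := by
  rcases hr with rfl | rfl | rfl
  · rw [spliceA_iff] at hs
    change Config w (ls ++ [ABC.a])
    cases h with
    | phaseA i m =>
      obtain ⟨m', hm, rfl⟩ := (insA_wordA _ _ _).1 hs
      obtain rfl : m = m' := by omega
      rw [← List.replicate_succ']
      cases m with
      | zero =>
        rw [wordA_zero]
        simpa using Config.phaseB i 0
      | succ m => exact .phaseA _ _
    | phaseB p q => exact (not_insA_wordB _ _ _ hs).elim
    | phaseC s t => exact (not_insA_wordC _ _ _ hs).elim
  · rw [spliceB_iff] at hs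
    change Config w (ls ++ [ABC.b])
    cases h with
    | phaseA i m => exact (not_insB_wordA _ _ _ hs).elim
    | phaseB p q =>
      obtain ⟨p', hp, rfl⟩ := (insB_wordB _ _ _).1 hs
      obtain rfl : p = p' := by omega
      rw [List.append_assoc, ← List.replicate_succ']
      cases p with
      | zero =>
        rw [wordB_zero]
        simpa [add_comm] using Config.phaseC 0 (q + 1)
      | succ p =>
        rw [add_assoc (p + 1), add_comm 1 q]
        exact .phaseB _ _
    | phaseC s t => exact (not_insB_wordC _ _ _ hs).elim
  · rw [spliceC_iff] at hs
    change Config w (ls ++ [ABC.c])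
    cases h with
    | phaseA i m => exact (not_insC_wordA _ _ _ hs).elim
    | phaseB p q => exact (not_insC_wordB _ _ _ hs).elim
    | phaseC s t =>
      obtain ⟨t', rfl, rfl⟩ := (insC_wordC _ _ _).1 hs
      rw [List.append_assoc, ← List.replicate_succ', ← add_assoc, add_right_comm]
      exact .phaseC _ _

lemma config_or_short_of_mem_initial {x : List Letter} (hx : x ∈ initial) :
    Config x [] ∨ ∃ l, x = [l] := by
  rcases hx with rfl | rfl | rfl | ⟨_ | k, rfl⟩
  · exact .inr ⟨_, rfl⟩
  · exact .inr ⟨_, rfl⟩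
  · exact .inr ⟨_, rfl⟩
  · exact .inl (.phaseC 0 0)
  · exact .inl (.phaseA 0 k)

lemma not_splice_singleton {r : FlatRule Letter} (hr : r ∈ system.R) (l : Letter)
    (v w : List Letter) : ¬ r.Splice [l] v w := by
  rintro ⟨x, y, z, h, -⟩
  have := congrArg List.length h
  rcases hr with rfl | rfl | rfl <;> simp [ruleA, ruleB, ruleC] at this <;> omega

lemma config_of_deriv {x : List Letter} {ls : List ABC} (h : system.Deriv x ls) :
    Config x ls := by
  induction h with
  | start hx hv hr hs =>
    rcases config_or_short_of_mem_initial hx with h | ⟨l, rfl⟩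
    · exact h.step hr ⟨_, hv, hs⟩
    · exact (not_splice_singleton hr l _ _ hs).elim
  | step _ hv hr hs ih => exact ih.step hr ⟨_, hv, hs⟩

lemma ne_nil_of_deriv {x : List Letter} {ls : List ABC} (h : system.Deriv x ls) : ls ≠ [] := by
  have lab_ne (r) : system.lab r ≠ [] := by
    simp only [system]
    split <;> simp
  cases h <;> simp [lab_ne]

lemma reach_wordA (i m : ℕ) : Reach (wordA i m) (List.replicate i .a) := by
  induction i generalizing m with
  | zero => exact .inl ⟨.inr (.inr (.inr ⟨m, rfl⟩)), rfl⟩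
  | succ i ih =>
    rw [List.replicate_succ']
    exact .inr ((ih (m + 1)).deriv (.inl rfl)
      ((spliceA_iff _ _).2 ((insA_wordA _ _ _).2 ⟨m, rfl, rfl⟩)))

lemma reach_wordB (p q : ℕ) :
    Reach (wordB p q) (List.replicate (p + q) .a ++ List.replicate q .b) := by
  induction q generalizing p with
  | zero => simpa [wordA_zero] using reach_wordA p 0
  | succ q ih =>
    rw [List.replicate_succ' (n := q), ← List.append_assoc, ← add_assoc, add_right_comm]
    exact .inr ((ih (p + 1)).deriv (.inr (.inl rfl))
      ((spliceB_iff _ _).2 ((insB_wordB _ _ _).2 ⟨p, rfl, rfl⟩)))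

lemma reach_wordC (s t : ℕ) :
    Reach (wordC s t) (List.replicate (s + t) .a ++ List.replicate (s + t) .b ++
      List.replicate s .c) := by
  induction s generalizing t with
  | zero => simpa [wordB_zero] using reach_wordB 0 t
  | succ s ih =>
    rw [List.replicate_succ' (n := s), ← List.append_assoc, add_assoc s, add_comm 1 t]
    exact .inr ((ih (t + 1)).deriv (.inr (.inr rfl))
      ((spliceC_iff _ _).2 ((insC_wordC _ _ _).2 ⟨t, rfl, rfl⟩)))

lemma derLang_system :
    system.derLang = { w : List ABC | ∃ k : ℕ, 1 ≤ k ∧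
      w = List.replicate k ABC.a ++ List.replicate k ABC.b ++ List.replicate k ABC.c } := by
  refine Set.ext fun ls => ⟨?_, ?_⟩
  · rintro ⟨x, hx, hterm⟩
    have hne := ne_nil_of_deriv hx
    rw [applicable_iff] at hterm
    cases config_of_deriv hx with
    | phaseA i m => exact (hterm ⟨_, .inl ((insA_wordA _ _ _).2 ⟨_, rfl, rfl⟩)⟩).elim
    | phaseB p q => exact (hterm ⟨_, .inr (.inl ((insB_wordB _ _ _).2 ⟨_, rfl, rfl⟩))⟩).elim
    | phaseC s t =>
      cases t with
      | zero => exact ⟨s, Nat.one_le_iff_ne_zero.2 (by rintro rfl; simp at hne), rfl⟩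
      | succ t => exact (hterm ⟨_, .inr (.inr ((insC_wordC _ _ _).2 ⟨_, rfl, rfl⟩))⟩).elim
  · rintro ⟨k, hk, rfl⟩
    refine ⟨wordC k 0, ?_, ?_⟩
    · rcases reach_wordC k 0 with ⟨-, h⟩ | h
      · simp at h
        omega
      · exact h
    · rw [applicable_iff]
      simp [not_insA_wordC, not_insB_wordC, insC_wordC]

end TripleCount

/-- The language `{aⁿbⁿcⁿ : n ≥ 1}` is the Szilard language of some labeled flat splicing
system of type `(4, 1)` whose initial set is a regular language. -/
theorem stmt9 :
    ∃ (A : Type) (_ : Finite A) (S : LabeledFSS A ABC),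
      S.SzilardLabeled ∧ Language.IsRegular (S.I : Language A) ∧ S.HasType 4 1 ∧
      S.derLang = { w : List ABC | ∃ k : ℕ, 1 ≤ k ∧
        w = List.replicate k ABC.a ++ List.replicate k ABC.b ++ List.replicate k ABC.c } := by
  refine ⟨TripleCount.Letter, inferInstance, TripleCount.system, ⟨?_, ?_⟩,
    TripleCount.isRegular_initial, ?_, TripleCount.derLang_system⟩
  · rintro r (rfl | rfl | rfl) <;> rfl
  · rintro r (rfl | rfl | rfl) r' (rfl | rfl | rfl) h <;> first | rfl | cases h
  · simp [LabeledFSS.HasType, TripleCount.system, TripleCount.ruleA, TripleCount.ruleB,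
      TripleCount.ruleC]
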